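/- Let Σ be the renewal shift, φ(x) = −x_0, and t ≥ 1. Suppose ν is a Borel measure on Σ and a ∈ ℕ with 0 < ν([a]) < ∞ and ∫ L_{tφ} f dν = e^{P_G(tφ)} ∫ f dν for every Borel measurable f : Σ → [0, ∞]. Then Z_n(tφ, a) ≤ exp(n·P_G(tφ)) for every n ≥ 1. -/

import Mathlib

open MeasureTheory Filter Topology BoundedContinuousFunction
open scoped ENNReal NNReal

noncomputable section

/-! ## Countable Markov shifts (one-sided) -/

/-- The one-sided countable Markov shift over the alphabet `ℕ` determined by the
transition matrix (relation) `A`. -/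
structure MShift (A : ℕ → ℕ → Prop) : Type where
  seq : ℕ → ℕ
  adm : ∀ i : ℕ, A (seq i) (seq (i + 1))

/-- The topology generated by the cylinders: the topology induced from the product
topology on `ℕ → ℕ` (with `ℕ` discrete). -/
instance (A : ℕ → ℕ → Prop) : TopologicalSpace (MShift A) :=
  TopologicalSpace.induced MShift.seq inferInstance

/-- The Borel σ-algebra on the shift space. -/
instance (A : ℕ → ℕ → Prop) : MeasurableSpace (MShift A) := borel (MShift A)

instance (A : ℕ → ℕ → Prop) : BorelSpace (MShift A) := ⟨rfl⟩

/-- The shift map `σ`. -/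
def shiftMap (A : ℕ → ℕ → Prop) (x : MShift A) : MShift A :=
  ⟨fun i => x.seq (i + 1), fun i => x.adm (i + 1)⟩

/-- No row and no column of the transition matrix is identically zero. -/
def NoZeroRC (A : ℕ → ℕ → Prop) : Prop :=
  ∀ i : ℕ, (∃ j, A i j) ∧ (∃ j, A j i)

/-- The cylinder `[x₀ … x_{n-1}]` determined by a finite word `w`. -/
def cylSet (A : ℕ → ℕ → Prop) (w : List ℕ) : Set (MShift A) :=
  {x | ∀ i < w.length, x.seq i = w.getD i 0}

/-- A path: an admissible word `x₀ … xₙ` with `n ≥ 1` and nonempty cylinder. -/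
def IsPath (A : ℕ → ℕ → Prop) (w : List ℕ) : Prop :=
  2 ≤ w.length ∧ w.Chain' A ∧ (cylSet A w).Nonempty

/-- The length `l(γ) = n` of a path `γ = x₀ … xₙ` (represented as a list of `n+1` symbols). -/
def pathLen (w : List ℕ) : ℕ := w.length - 1

/-- The weight `φ(γ) = Σ_{k=0}^{n-1} ψ(x_k x_{k+1})` of a word under a Markov
potential determined by `ψ : ℕ → ℕ → ℝ`. -/
def pathWt (ψ : ℕ → ℕ → ℝ) : List ℕ → ℝ
  | [] => 0
  | [_] => 0
  | a :: b :: l => ψ a b + pathWt ψ (b :: l)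

/-- Topological transitivity: any two symbols are connected by a path. -/
def TopTrans (A : ℕ → ℕ → Prop) : Prop :=
  ∀ a b : ℕ, ∃ w : List ℕ, IsPath A w ∧ w.headI = a ∧ w.getLastD 0 = b

/-- The Birkhoff sum `Sₙφ`. -/
def birkhoff (A : ℕ → ℕ → Prop) (φ : MShift A → ℝ) (n : ℕ) (x : MShift A) : ℝ :=
  ∑ i ∈ Finset.range n, φ ((shiftMap A)^[i] x)

/-- The Gurevich partition function `Zₙ(φ, a)`. -/
def Zpart (A : ℕ → ℕ → Prop) (φ : MShift A → ℝ) (n : ℕ) (a : ℕ) : ℝ≥0∞ :=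
  ∑' x : {x : MShift A // (shiftMap A)^[n] x = x ∧ x.seq 0 = a},
    ENNReal.ofReal (Real.exp (birkhoff A φ n x.1))

/-- `Zₙ*(φ, a)`: the partition function restricted to first returns to `a`. -/
def ZpartStar (A : ℕ → ℕ → Prop) (φ : MShift A → ℝ) (n : ℕ) (a : ℕ) : ℝ≥0∞ :=
  ∑' x : {x : MShift A // (shiftMap A)^[n] x = x ∧ x.seq 0 = a ∧
      ∀ k, 0 < k → k < n → x.seq k ≠ a},
    ENNReal.ofReal (Real.exp (birkhoff A φ n x.1))

/-- The Gurevich pressure `P_G(φ) = limsup (1/n) log Zₙ(φ, a)` (at the symbol `a`),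
as an extended real number. -/
def PGur (A : ℕ → ℕ → Prop) (φ : MShift A → ℝ) (a : ℕ) : EReal :=
  Filter.atTop.limsup fun n : ℕ => (((n : ℝ)⁻¹ : ℝ) : EReal) * ENNReal.log (Zpart A φ n a)

/-- `p` is the (common, symbol-independent) value of the Gurevich pressure of `φ`. -/
def IsPG (A : ℕ → ℕ → Prop) (φ : MShift A → ℝ) (p : EReal) : Prop :=
  ∀ a : ℕ, (∃ x : MShift A, x.seq 0 = a) → PGur A φ a = p

/-- `φ` is a summable potential: `Σᵢ exp (sup φ|_[i]) < ∞`. -/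
def SummablePot (A : ℕ → ℕ → Prop) (φ : MShift A → ℝ) : Prop :=
  ∃ s : ℕ → ℝ, Summable (fun i => Real.exp (s i)) ∧
    ∀ (i : ℕ) (x : MShift A), x.seq 0 = i → φ x ≤ s i

/-- `V` is a bound for the `n`-th variation `Varₙ(φ)`. -/
def VarBdd (A : ℕ → ℕ → Prop) (φ : MShift A → ℝ) (n : ℕ) (V : ℝ) : Prop :=
  ∀ x y : MShift A, (∀ i < n, x.seq i = y.seq i) → |φ x - φ y| ≤ V

/-- σ-invariance of a Borel measure on the shift space. -/
def ShiftInv (A : ℕ → ℕ → Prop) (μ : Measure (MShift A)) : Prop :=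
  ∀ s : Set (MShift A), MeasurableSet s → μ (shiftMap A ⁻¹' s) = μ s

/-- The maximal ergodic average `α(φ)`. -/
def alphaSup (A : ℕ → ℕ → Prop) (φ : MShift A → ℝ) : ℝ :=
  sSup {r : ℝ | ∃ μ : Measure (MShift A), IsProbabilityMeasure μ ∧ ShiftInv A μ ∧
    Integrable φ μ ∧ r = ∫ x, φ x ∂μ}

/-- `μ` is the Gurevich–Markov (stationary Markov equilibrium) measure associated to the
Markov potential `ψ` with pressure `p`. -/
structure IsGM (A : ℕ → ℕ → Prop) (ψ : ℕ → ℕ → ℝ) (p : ℝ) (μ : Measure (MShift A)) : Prop where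
  prob : IsProbabilityMeasure μ
  inv : ShiftInv A μ
  eigen : ∃ h hT : ℕ → ℝ, (∀ a, 0 < h a) ∧ (∀ a, 0 < hT a) ∧
    (∀ j : ℕ, (∑' a : {a : ℕ // A a j}, ENNReal.ofReal (Real.exp (ψ a.1 j) * h a.1))
        = ENNReal.ofReal (Real.exp p * h j)) ∧
    (∀ j : ℕ, (∑' b : {b : ℕ // A j b}, ENNReal.ofReal (Real.exp (ψ j b.1) * hT b.1))
        = ENNReal.ofReal (Real.exp p * hT j)) ∧
    (∑' a : ℕ, ENNReal.ofReal (h a * hT a)) = 1 ∧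
    (∀ w : List ℕ, w ≠ [] → w.Chain' A → (cylSet A w).Nonempty →
      μ (cylSet A w) = ENNReal.ofReal
        (h w.headI * hT (w.getLastD 0) * Real.exp (pathWt ψ w - (pathLen w : ℝ) * p)))

/-! ## Loops and main paths (one-sided) -/

/-- A loop at `a`. -/
def IsLoopAt (A : ℕ → ℕ → Prop) (a : ℕ) (w : List ℕ) : Prop :=
  IsPath A w ∧ w.headI = a ∧ w.getLastD 0 = a

/-- The word `w` passes through `b`, i.e. some intermediate symbol of `w` equals `b`. -/
def PassesThrough (w : List ℕ) (b : ℕ) : Prop :=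
  ∃ m, 0 < m ∧ m < w.length - 1 ∧ w.getD m 0 = b

/-- No intermediate symbol of `w` lies in `J`. -/
def AvoidsIn (w : List ℕ) (J : Finset ℕ) : Prop :=
  ∀ m, 0 < m → m < w.length - 1 → w.getD m 0 ∉ J

/-- A first-return loop at `c`: a loop at `c` with no intermediate occurrence of `c`. -/
def FirstRetLoop (A : ℕ → ℕ → Prop) (c : ℕ) (w : List ℕ) : Prop :=
  IsPath A w ∧ w.headI = c ∧ w.getLastD 0 = c ∧
    ∀ m, 0 < m → m < w.length - 1 → w.getD m 0 ≠ c

/-- A main path from `i` to `j` (relative to the pair of symbols `{a, b}`): a path from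
`i` to `j` with no intermediate occurrence of `a` nor of `b`. -/
def MainPath (A : ℕ → ℕ → Prop) (a b i j : ℕ) (w : List ℕ) : Prop :=
  IsPath A w ∧ w.headI = i ∧ w.getLastD 0 = j ∧
    ∀ m, 0 < m → m < w.length - 1 → w.getD m 0 ≠ a ∧ w.getD m 0 ≠ b

/-- `p_{ij}^t`: the sum of `exp(ψ(γ) − l(γ)·p)` over all main paths from `i` to `j`. -/
def pSum (A : ℕ → ℕ → Prop) (ψ : ℕ → ℕ → ℝ) (p : ℝ) (a b i j : ℕ) : ℝ≥0∞ :=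
  ∑' w : {w : List ℕ // MainPath A a b i j w},
    ENNReal.ofReal (Real.exp (pathWt ψ w.1 - (pathLen w.1 : ℝ) * p))

/-- `r_{ij}^t`: as `pSum`, restricted to main paths all of whose symbols lie in `S'`. -/
def rSum (A : ℕ → ℕ → Prop) (ψ : ℕ → ℕ → ℝ) (p : ℝ) (a b i j : ℕ) (S' : Finset ℕ) : ℝ≥0∞ :=
  ∑' w : {w : List ℕ // MainPath A a b i j w ∧ ∀ m < w.length, w.getD m 0 ∈ S'},
    ENNReal.ofReal (Real.exp (pathWt ψ w.1 - (pathLen w.1 : ℝ) * p))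

/-- Number of intermediate occurrences of symbols of `I` in the word `w`. -/
def interCount (I : Finset ℕ) (w : List ℕ) : ℕ :=
  ((w.drop 1).take (w.length - 2)).countP (fun s => decide (s ∈ I))

/-- `p_{ij}^t(n)`: as `pSum`, restricted to main paths with exactly `n` intermediate
occurrences of symbols of `I`. -/
def pSumN (A : ℕ → ℕ → Prop) (ψ : ℕ → ℕ → ℝ) (p : ℝ) (a b i j : ℕ)
    (I : Finset ℕ) (n : ℕ) : ℝ≥0∞ :=
  ∑' w : {w : List ℕ // MainPath A a b i j w ∧ interCount I w = n},
    ENNReal.ofReal (Real.exp (pathWt ψ w.1 - (pathLen w.1 : ℝ) * p))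

/-- An `I`-free path from `i` to `j`: a path from `i` to `j` with no intermediate
symbol in `I`. -/
def IFree (A : ℕ → ℕ → Prop) (I : Finset ℕ) (i j : ℕ) (w : List ℕ) : Prop :=
  IsPath A w ∧ w.headI = i ∧ w.getLastD 0 = j ∧
    ∀ m, 0 < m → m < w.length - 1 → w.getD m 0 ∉ I

/-! ## Two-sided countable Markov shifts -/

/-- The two-sided countable Markov shift determined by `A`. -/
structure MShift2 (A : ℕ → ℕ → Prop) : Type where
  seq : ℤ → ℕ
  adm : ∀ i : ℤ, A (seq i) (seq (i + 1))

instance (A : ℕ → ℕ → Prop) : TopologicalSpace (MShift2 A) :=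
  TopologicalSpace.induced MShift2.seq inferInstance

instance (A : ℕ → ℕ → Prop) : MeasurableSpace (MShift2 A) := borel (MShift2 A)

instance (A : ℕ → ℕ → Prop) : BorelSpace (MShift2 A) := ⟨rfl⟩

/-- The (invertible) shift map on the two-sided shift. -/
def shiftMap2 (A : ℕ → ℕ → Prop) (x : MShift2 A) : MShift2 A :=
  ⟨fun i => x.seq (i + 1), fun i => x.adm (i + 1)⟩

/-- Cylinder based at coordinate 0 in the two-sided shift. -/
def cylSet2 (A : ℕ → ℕ → Prop) (w : List ℕ) : Set (MShift2 A) :=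
  {x | ∀ i < w.length, x.seq (i : ℤ) = w.getD i 0}

/-- A path in the two-sided shift: an admissible word `x₀ … xₙ`, `n ≥ 1`. -/
def IsPath2 (A : ℕ → ℕ → Prop) (w : List ℕ) : Prop :=
  2 ≤ w.length ∧ w.Chain' A

/-- σ-invariance of a Borel measure on the two-sided shift. -/
def ShiftInv2 (A : ℕ → ℕ → Prop) (μ : Measure (MShift2 A)) : Prop :=
  ∀ s : Set (MShift2 A), MeasurableSet s → μ (shiftMap2 A ⁻¹' s) = μ s

/-- Main path from `i` to `j` relative to `{a, b}` in the two-sided shift. -/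
def MainPath2 (A : ℕ → ℕ → Prop) (a b i j : ℕ) (w : List ℕ) : Prop :=
  IsPath2 A w ∧ w.headI = i ∧ w.getLastD 0 = j ∧
    ∀ m, 0 < m → m < w.length - 1 → w.getD m 0 ≠ a ∧ w.getD m 0 ≠ b

/-- `p_{ij}`: the sum of `exp(ψ(γ) − l(γ)·P)` over all main paths from `i` to `j`
in the two-sided shift. -/
def pSum2 (A : ℕ → ℕ → Prop) (ψ : ℕ → ℕ → ℝ) (P : ℝ) (a b i j : ℕ) : ℝ≥0∞ :=
  ∑' w : {w : List ℕ // MainPath2 A a b i j w},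
    ENNReal.ofReal (Real.exp (pathWt ψ w.1 - (pathLen w.1 : ℝ) * P))

/-! ## The Ruelle operator and the renewal shift -/

/-- The Ruelle (transfer) operator acting on nonnegative measurable functions. -/
def ruelleOp (A : ℕ → ℕ → Prop) (ψ : MShift A → ℝ) (f : MShift A → ℝ≥0∞)
    (x : MShift A) : ℝ≥0∞ :=
  ∑' y : {y : MShift A // shiftMap A y = x}, ENNReal.ofReal (Real.exp (ψ y.1)) * f y.1

/-- The transition matrix of the renewal shift: `A(1,1) = A(1,i) = A(i, i-1) = 1` for
every `i > 1`, all other entries `0` (alphabet `{1, 2, …}`). -/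
def renewalA : ℕ → ℕ → Prop := fun i j => (i = 1 ∧ 1 ≤ j) ∨ (2 ≤ i ∧ j = i - 1)

/-- The potential `φ(x) = -x₀` on the renewal shift. -/
def phiRen : MShift renewalA → ℝ := fun x => -(x.seq 0 : ℝ)

/-- The potential `φ(x) = x₀ - x₁` on the renewal shift. -/
def phiRen2 : MShift renewalA → ℝ := fun x => (x.seq 0 : ℝ) - (x.seq 1 : ℝ)

/-- The fixed point `1̄ = (1,1,1,…)` of the renewal shift. -/
def onebar : MShift renewalA := ⟨fun _ => 1, fun _ => Or.inl ⟨rfl, le_refl 1⟩⟩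

end

section RuelleIteration

variable {A : ℕ → ℕ → Prop}

theorem MShift.ext_seq {x y : MShift A} (h : ∀ i, x.seq i = y.seq i) : x = y := by
  cases x; cases y; congr; exact funext h

theorem measurable_seq_zero : Measurable fun x : MShift A => x.seq 0 :=
  ((continuous_apply (A := fun _ : ℕ => ℕ) 0).comp
    (continuous_induced_dom (f := MShift.seq))).measurable

theorem shiftMap_iterate_seq (n : ℕ) (x : MShift A) (i : ℕ) :
    ((shiftMap A)^[n] x).seq i = x.seq (i + n) := by
  induction n generalizing x with
  | zero => rfl
  | succ n ih =>
    rw [Function.iterate_succ_apply, ih]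
    change x.seq (i + n + 1) = _
    rw [add_assoc]

/-- Preimages of `x` under the shift correspond to the symbols that may precede `x₀`. -/
def preimageEquiv (x : MShift A) :
    {y : MShift A // shiftMap A y = x} ≃ {i : ℕ // A i (x.seq 0)} where
  toFun y := ⟨y.1.seq 0, by
    have h := y.1.adm 0
    have h' : y.1.seq (0 + 1) = x.seq 0 := congrArg (fun z : MShift A => z.seq 0) y.2
    rwa [h'] at h⟩
  invFun i := ⟨⟨fun k => Nat.casesOn k i.1 x.seq, fun k => by
    cases k with
    | zero => exact i.2
    | succ k => exact x.adm k⟩, rfl⟩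
  left_inv y := by
    obtain ⟨y, rfl⟩ := y
    refine Subtype.ext (MShift.ext_seq fun k => ?_)
    cases k <;> rfl
  right_inv i := rfl

/-- The Ruelle operator of a potential depending on `x₀` preserves functions of `x₀`. -/
theorem ruelleOp_comp_seq_zero (v : ℕ → ℝ) (u : ℕ → ℝ≥0∞) (x : MShift A) :
    ruelleOp A (fun y => v (y.seq 0)) (fun y => u (y.seq 0)) x
      = ∑' i : {i : ℕ // A i (x.seq 0)}, ENNReal.ofReal (Real.exp (v i)) * u i :=
  (preimageEquiv x).tsum_eq
    fun i : {i : ℕ // A i (x.seq 0)} => ENNReal.ofReal (Real.exp (v i)) * u i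

theorem exists_iterate_ruelleOp_eq_comp (v : ℕ → ℝ) (u : ℕ → ℝ≥0∞) (n : ℕ) :
    ∃ w : ℕ → ℝ≥0∞,
      (ruelleOp A fun y => v (y.seq 0))^[n] (fun y => u (y.seq 0)) = fun x => w (x.seq 0) := by
  induction n with
  | zero => exact ⟨u, rfl⟩
  | succ n ih =>
    obtain ⟨w, hw⟩ := ih
    refine ⟨fun j => ∑' i : {i : ℕ // A i j}, ENNReal.ofReal (Real.exp (v i)) * w i, ?_⟩
    rw [Function.iterate_succ_apply', hw]
    exact funext fun x => ruelleOp_comp_seq_zero v w x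

/-- A point of `σ⁻⁽ⁿ⁺¹⁾ x` is a point of `σ⁻ⁿ y` for a unique `y ∈ σ⁻¹ x`. -/
def iteratePreimageEquiv (n : ℕ) (x : MShift A) :
    (Σ y : {y : MShift A // shiftMap A y = x}, {z : MShift A // (shiftMap A)^[n] z = y}) ≃
      {z : MShift A // (shiftMap A)^[n + 1] z = x} where
  toFun p := ⟨p.2.1, by rw [Function.iterate_succ_apply', p.2.2, p.1.2]⟩
  invFun z := ⟨⟨(shiftMap A)^[n] z, (Function.iterate_succ_apply' _ n z.1).symm.trans z.2⟩, ⟨z, rfl⟩⟩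
  left_inv := by
    rintro ⟨⟨y, hy⟩, ⟨z, hz⟩⟩
    obtain rfl : (shiftMap A)^[n] z = y := hz
    rfl
  right_inv _ := rfl

theorem iterate_ruelleOp_apply (ψ : MShift A → ℝ) (f : MShift A → ℝ≥0∞) (n : ℕ) (x : MShift A) :
    (ruelleOp A ψ)^[n] f x = ∑' z : {z : MShift A // (shiftMap A)^[n] z = x},
      ENNReal.ofReal (Real.exp (birkhoff A ψ n z)) * f z := by
  induction n generalizing x with
  | zero =>
    rw [tsum_eq_single (⟨x, rfl⟩ : {z : MShift A // (shiftMap A)^[0] z = x})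
      fun z hz => absurd (Subtype.ext z.2) hz]
    simp [birkhoff]
  | succ n ih =>
    rw [Function.iterate_succ_apply', ← (iteratePreimageEquiv n x).tsum_eq, ENNReal.tsum_sigma']
    refine tsum_congr fun y => ?_
    rw [ih, ← ENNReal.tsum_mul_left]
    refine tsum_congr fun z => ?_
    rw [← mul_assoc, ← ENNReal.ofReal_mul (Real.exp_nonneg _), ← Real.exp_add]
    change _ = ENNReal.ofReal (Real.exp (birkhoff A ψ (n + 1) z.1)) * _
    have h : birkhoff A ψ (n + 1) z.1 = ψ y + birkhoff A ψ n z := by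
      rw [birkhoff, Finset.sum_range_succ, z.2, add_comm]
      rfl
    rw [h]
    rfl

/-- Follow the first `n` symbols of `z` by `x`. -/
def concat (n : ℕ) (z x : MShift A) (h : z.seq n = x.seq 0) : MShift A where
  seq i := if i < n then z.seq i else x.seq (i - n)
  adm i := by
    rcases lt_trichotomy (i + 1) n with hi | hi | hi
    · simpa [hi, (Nat.lt_succ_self i).trans hi] using z.adm i
    · subst hi
      simpa [← h] using z.adm i
    · have h1 : ¬ i < n := by omega
      have h2 : ¬ i + 1 < n := by omega
      rw [if_neg h1, if_neg h2, Nat.sub_add_comm (by omega)]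
      exact x.adm _

/-- `Zₙ(ψ, a)` is at most `L_ψⁿ 1_[a]` on the cylinder `[a]` when `ψ` depends on `x₀` only. -/
theorem Zpart_le_iterate_ruelleOp (v : ℕ → ℝ) {n : ℕ} (hn : 1 ≤ n) (x : MShift A) :
    Zpart A (fun y => v (y.seq 0)) n (x.seq 0) ≤
      (ruelleOp A fun y => v (y.seq 0))^[n]
        (fun y => if y.seq 0 = x.seq 0 then 1 else 0) x := by
  have hper (z : MShift A) (hz : (shiftMap A)^[n] z = z) (i : ℕ) : z.seq (i + n) = z.seq i := by
    rw [← shiftMap_iterate_seq, hz]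
  let c (z : {z : MShift A // (shiftMap A)^[n] z = z ∧ z.seq 0 = x.seq 0}) :
      {y : MShift A // (shiftMap A)^[n] y = x} :=
    ⟨concat n z.1 x (by simpa using (hper z.1 z.2.1 0).trans z.2.2),
      MShift.ext_seq fun i => by rw [shiftMap_iterate_seq]; simp [concat]⟩
  have hc_seq (z) {i : ℕ} (hi : i < n) : (c z).1.seq i = z.1.seq i := if_pos hi
  have hc_inj : Function.Injective c := by
    intro z w hzw
    have key (i : ℕ) : z.1.seq i = w.1.seq i := by
      induction i using Nat.strong_induction_on with
      | _ i ih =>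
        by_cases hi : i < n
        · rw [← hc_seq z hi, ← hc_seq w hi, hzw]
        · obtain ⟨k, rfl⟩ := Nat.exists_eq_add_of_le' (not_lt.mp hi)
          rw [hper z.1 z.2.1, hper w.1 w.2.1]
          exact ih k (by omega)
    exact Subtype.ext (MShift.ext_seq key)
  rw [iterate_ruelleOp_apply]
  refine le_trans (le_of_eq (tsum_congr fun z => ?_))
    (ENNReal.tsum_comp_le_tsum_of_injective hc_inj _)
  have hb : birkhoff A (fun y => v (y.seq 0)) n z.1
      = birkhoff A (fun y => v (y.seq 0)) n (c z).1 := by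
    refine Finset.sum_congr rfl fun i hi => ?_
    beta_reduce
    rw [shiftMap_iterate_seq, shiftMap_iterate_seq, zero_add,
      hc_seq z (Finset.mem_range.mp hi)]
  rw [hb, if_pos ((hc_seq z hn).trans z.2.2), mul_one]

theorem lintegral_iterate_ruelleOp (ν : Measure (MShift A)) (v : ℕ → ℝ) (r : ℝ≥0∞)
    (heig : ∀ f : MShift A → ℝ≥0∞, Measurable f →
      ∫⁻ x, ruelleOp A (fun y => v (y.seq 0)) f x ∂ν = r * ∫⁻ x, f x ∂ν)
    (u : ℕ → ℝ≥0∞) (n : ℕ) :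
    ∫⁻ x, (ruelleOp A fun y => v (y.seq 0))^[n] (fun y => u (y.seq 0)) x ∂ν
      = r ^ n * ∫⁻ x, u (x.seq 0) ∂ν := by
  induction n with
  | zero => simp
  | succ n ih =>
    obtain ⟨w, hw⟩ := exists_iterate_ruelleOp_eq_comp (A := A) v u n
    rw [Function.iterate_succ_apply', heig _ (by
      rw [hw]; exact (measurable_of_countable w).comp measurable_seq_zero), ih, pow_succ',
      mul_assoc]

theorem mem_cylSet_singleton {a : ℕ} {x : MShift A} : x ∈ cylSet A [a] ↔ x.seq 0 = a := by
  simp [cylSet]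

theorem measurableSet_cylSet_singleton (a : ℕ) : MeasurableSet (cylSet A [a]) := by
  have h : cylSet A [a] = (fun x : MShift A => x.seq 0) ⁻¹' {a} :=
    Set.ext fun _ => mem_cylSet_singleton
  rw [h]
  exact measurable_seq_zero (measurableSet_singleton a)

/-- An eigenmeasure of the dual Ruelle operator that is positive and finite on `[a]` bounds
`Zₙ(ψ, a)` by the powers of its eigenvalue. -/
theorem Zpart_le_pow_of_eigenmeasure (ν : Measure (MShift A)) (v : ℕ → ℝ) (r : ℝ≥0∞)
    (heig : ∀ f : MShift A → ℝ≥0∞, Measurable f →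
      ∫⁻ x, ruelleOp A (fun y => v (y.seq 0)) f x ∂ν = r * ∫⁻ x, f x ∂ν)
    {a : ℕ} (hν0 : ν (cylSet A [a]) ≠ 0) (hνfin : ν (cylSet A [a]) ≠ ⊤) {n : ℕ} (hn : 1 ≤ n) :
    Zpart A (fun y => v (y.seq 0)) n a ≤ r ^ n := by
  let u : ℕ → ℝ≥0∞ := fun i => if i = a then 1 else 0
  have hcyl := measurableSet_cylSet_singleton (A := A) a
  have hu : ∫⁻ x : MShift A, u (x.seq 0) ∂ν = ν (cylSet A [a]) := by
    rw [← lintegral_indicator_one hcyl]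
    refine lintegral_congr fun x => ?_
    simp only [u, Set.indicator, mem_cylSet_singleton, Pi.one_apply]
  refine (ENNReal.mul_le_mul_iff_left hν0 hνfin).mp ?_
  calc Zpart A (fun y => v (y.seq 0)) n a * ν (cylSet A [a])
      = ∫⁻ _ in cylSet A [a], Zpart A (fun y => v (y.seq 0)) n a ∂ν := by
        rw [setLIntegral_const]
    _ ≤ ∫⁻ x in cylSet A [a],
          (ruelleOp A fun y => v (y.seq 0))^[n] (fun y => u (y.seq 0)) x ∂ν := by
        refine setLIntegral_mono' hcyl fun x hx => ?_
        obtain rfl := mem_cylSet_singleton.mp hx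
        exact Zpart_le_iterate_ruelleOp v hn x
    _ ≤ ∫⁻ x, (ruelleOp A fun y => v (y.seq 0))^[n] (fun y => u (y.seq 0)) x ∂ν :=
        setLIntegral_le_lintegral _ _
    _ = r ^ n * ν (cylSet A [a]) := by
        rw [lintegral_iterate_ruelleOp ν v r heig, hu]

end RuelleIteration

/-- On the renewal shift with `φ(x) = −x₀`, if `ν` is an eigenmeasure
of the dual Ruelle operator with eigenvalue `e^{P_G(tφ)}` and `0 < ν([a]) < ∞`, then
`Zₙ(tφ, a) ≤ exp(n·P_G(tφ))` for every `n ≥ 1`. -/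
theorem stmt14 (t : ℝ) (ht : 1 ≤ t) (P : ℝ)
    (hP : IsPG renewalA (fun x => t * phiRen x) ((P : ℝ) : EReal))
    (ν : Measure (MShift renewalA)) (a : ℕ) (ha : 1 ≤ a)
    (hν0 : 0 < ν (cylSet renewalA [a])) (hνfin : ν (cylSet renewalA [a]) < ⊤)
    (heig : ∀ f : MShift renewalA → ℝ≥0∞, Measurable f →
      ∫⁻ x, ruelleOp renewalA (fun y => t * phiRen y) f x ∂ν
        = ENNReal.ofReal (Real.exp P) * ∫⁻ x, f x ∂ν) :
    ∀ n : ℕ, 1 ≤ n →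
      Zpart renewalA (fun x => t * phiRen x) n a
        ≤ ENNReal.ofReal (Real.exp ((n : ℝ) * P)) := by
  intro n hn
  rw [Real.exp_nat_mul, ENNReal.ofReal_pow (Real.exp_nonneg P)]
  exact Zpart_le_pow_of_eigenmeasure ν (fun i => t * -(i : ℝ)) _ heig hν0.ne' hνfin.ne hn
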